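/- Let G be a graph with no long theta, and let K be a tidy shortest long near-prism in G with constituent paths P1, P2, P3. Let x, y be nonadjacent K-major vertices. If i, j ∈ {1,2,3} are such that x has no neighbours in V(P_i) and y has no neighbours in V(P_j), then i = j. -/

import Mathlib

open SimpleGraph

namespace LEH

open scoped Classical

variable {V : Type*}

/-- `X` is anticomplete to `Y`: they are disjoint and there are no edges between them. -/
def Anticomplete (G : SimpleGraph V) (X Y : Set V) : Prop :=
  ∀ ⦃x⦄, x ∈ X → ∀ ⦃y⦄, y ∈ Y → x ≠ y ∧ ¬ G.Adj x y

/-- The vertex set of a walk. -/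
def vset {G : SimpleGraph V} {u v : V} (P : G.Walk u v) : Set V :=
  {x | x ∈ P.support}

/-- The interior of a path: its non-end vertices. -/
def inter {G : SimpleGraph V} {u v : V} (P : G.Walk u v) : Set V :=
  {x | x ∈ P.support ∧ x ≠ u ∧ x ≠ v}

/-- An induced path in `G`. -/
def IsInducedPath {G : SimpleGraph V} {u v : V} (P : G.Walk u v) : Prop :=
  P.IsPath ∧ ∀ x ∈ P.support, ∀ y ∈ P.support, G.Adj x y → s(x, y) ∈ P.edges

/-- A hole: an induced cycle of length at least 4. -/
def IsHole {G : SimpleGraph V} {u : V} (c : G.Walk u u) : Prop :=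
  c.IsCycle ∧ 4 ≤ c.length ∧
    ∀ x ∈ c.support, ∀ y ∈ c.support, G.Adj x y → s(x, y) ∈ c.edges

/-- A long even hole: a hole of even length at least `ℓ`. -/
def IsLongEvenHole (ℓ : ℕ) {G : SimpleGraph V} {u : V} (c : G.Walk u u) : Prop :=
  IsHole c ∧ ℓ ≤ c.length ∧ Even c.length

def HasLongEvenHole (G : SimpleGraph V) (ℓ : ℕ) : Prop :=
  ∃ (u : V) (c : G.Walk u u), IsLongEvenHole ℓ c

/-- A long theta in `G`: two nonadjacent vertices joined by three internally disjoint
induced paths with no edges between their interiors, any two of which form a long hole. -/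
def HasLongTheta (G : SimpleGraph V) (ℓ : ℕ) : Prop :=
  ∃ (u v : V) (P₁ P₂ P₃ : G.Walk u v),
    u ≠ v ∧ ¬ G.Adj u v ∧
    IsInducedPath P₁ ∧ IsInducedPath P₂ ∧ IsInducedPath P₃ ∧
    Anticomplete G (inter P₁) (inter P₂) ∧
    Anticomplete G (inter P₁) (inter P₃) ∧
    Anticomplete G (inter P₂) (inter P₃) ∧
    ℓ ≤ P₁.length + P₂.length ∧ ℓ ≤ P₁.length + P₃.length ∧
    ℓ ≤ P₂.length + P₃.length

/-- A long jewel of order `k` formed by `Q₁, Q₂, P`. -/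
def IsLongJewel (ℓ k : ℕ) {G : SimpleGraph V} {u v : V}
    (Q₁ Q₂ P : G.Walk u v) : Prop :=
  u ≠ v ∧
  IsInducedPath Q₁ ∧ IsInducedPath Q₂ ∧ IsInducedPath P ∧
  ¬ (Even Q₁.length ↔ Even Q₂.length) ∧
  max Q₁.support.length Q₂.support.length = k ∧
  ℓ ≤ P.length + min Q₁.length Q₂.length ∧
  Anticomplete G (inter P) (inter Q₁ ∪ inter Q₂)

def HasLongJewel (G : SimpleGraph V) (ℓ k : ℕ) : Prop :=
  ∃ (u v : V) (Q₁ Q₂ P : G.Walk u v), IsLongJewel ℓ k Q₁ Q₂ P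

/-- A long ban-the-bomb in `G`. -/
def IsLongBanTheBomb (ℓ : ℕ) {G : SimpleGraph V} (u v₁ w v₂ x : V)
    (P₁ : G.Walk x v₁) (P₂ : G.Walk x v₂) : Prop :=
  G.Adj u v₁ ∧ G.Adj v₁ w ∧ G.Adj w v₂ ∧ G.Adj v₂ u ∧ ¬ G.Adj v₁ v₂ ∧ u ≠ w ∧
  G.Adj x u ∧ ¬ G.Adj x v₁ ∧ ¬ G.Adj x v₂ ∧ ¬ G.Adj x w ∧
  x ≠ v₁ ∧ x ≠ v₂ ∧ x ≠ w ∧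
  IsInducedPath P₁ ∧ IsInducedPath P₂ ∧
  2 ≤ P₁.length ∧ 2 ≤ P₂.length ∧
  Anticomplete G (inter P₁) {u, w} ∧ Anticomplete G (inter P₂) {u, w} ∧
  Anticomplete G (vset P₁ \ {x}) (vset P₂ \ {x}) ∧
  ℓ ≤ P₁.length + 2 ∧ ℓ ≤ P₂.length + 2 ∧ ℓ ≤ P₁.length + P₂.length + 2

def HasLongBanTheBomb (G : SimpleGraph V) (ℓ : ℕ) : Prop :=
  ∃ (u v₁ w v₂ x : V) (P₁ : G.Walk x v₁) (P₂ : G.Walk x v₂),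
    IsLongBanTheBomb ℓ u v₁ w v₂ x P₁ P₂

/-- The induced subgraph of `G` on the vertex set `S` is a long hole. -/
def IsLongHoleOn (G : SimpleGraph V) (ℓ : ℕ) (S : Set V) : Prop :=
  ∃ (u : V) (c : G.Walk u u), IsHole c ∧ ℓ ≤ c.length ∧ {x | x ∈ c.support} = S

/-- A long near-prism with triangles `{a 0, a 1, a 2}`, `{b 0, b 1, b 2}` and
constituent paths `P 0, P 1, P 2`. -/
def IsLongNearPrism (ℓ : ℕ) {G : SimpleGraph V} (a b : Fin 3 → V)
    (P : ∀ i : Fin 3, G.Walk (a i) (b i)) : Prop :=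
  (∀ i j, i ≠ j → G.Adj (a i) (a j)) ∧
  (∀ i j, i ≠ j → G.Adj (b i) (b j)) ∧
  (Set.range a ∩ Set.range b).Subsingleton ∧
  (∀ i, (P i).IsPath) ∧
  (∀ i j, i ≠ j → ∀ x, x ∈ (P i).support → x ∉ (P j).support) ∧
  (∀ i j, i ≠ j → IsLongHoleOn G ℓ (vset (P i) ∪ vset (P j)))

def HasLongNearPrism (G : SimpleGraph V) (ℓ : ℕ) : Prop :=
  ∃ (a b : Fin 3 → V) (P : ∀ i : Fin 3, G.Walk (a i) (b i)), IsLongNearPrism ℓ a b P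

/-- A prospect: no long even hole of length at most `2ℓ`, no long jewel of order at most
`ℓ+1`, no long theta and no long ban-the-bomb. -/
def Prospect (G : SimpleGraph V) (ℓ : ℕ) : Prop :=
  (¬ ∃ (u : V) (c : G.Walk u u), IsLongEvenHole ℓ c ∧ c.length ≤ 2 * ℓ) ∧
  (¬ ∃ k ≤ ℓ + 1, HasLongJewel G ℓ k) ∧
  ¬ HasLongTheta G ℓ ∧ ¬ HasLongBanTheBomb G ℓ

/-- A candidate : a prospect with no long near-prism. -/
def Candidate (G : SimpleGraph V) (ℓ : ℕ) : Prop :=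
  Prospect G ℓ ∧ ¬ HasLongNearPrism G ℓ

/-- The vertex set of a near-prism. -/
def prismSupport {G : SimpleGraph V} {a b : Fin 3 → V}
    (P : ∀ i : Fin 3, G.Walk (a i) (b i)) : Set V :=
  ⋃ i, vset (P i)

/-- The near-prism, as a graph on `V`. -/
def prismGraph (G : SimpleGraph V) (a b : Fin 3 → V)
    (P : ∀ i : Fin 3, G.Walk (a i) (b i)) : SimpleGraph V :=
  SimpleGraph.fromEdgeSet
    ({e | ∃ i j, i ≠ j ∧ e = s(a i, a j)} ∪ {e | ∃ i j, i ≠ j ∧ e = s(b i, b j)} ∪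
      {e | ∃ i, e ∈ (P i).edges})

/-- `q` is `K`-major: `q` is outside the near-prism `K`, and no path of `K` with at most
three vertices contains all neighbours of `q` in `V(K)`. -/
def KMajor (G : SimpleGraph V) {a b : Fin 3 → V}
    (P : ∀ i : Fin 3, G.Walk (a i) (b i)) (q : V) : Prop :=
  q ∉ prismSupport P ∧
  ¬ ∃ (x y : V) (W : (prismGraph G a b P).Walk x y), W.IsPath ∧ W.length ≤ 2 ∧
      ∀ z ∈ prismSupport P, G.Adj q z → z ∈ W.support

/-- A shortest long near-prism. -/
def ShortestLNP (G : SimpleGraph V) (ℓ : ℕ) {a b : Fin 3 → V}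
    (P : ∀ i : Fin 3, G.Walk (a i) (b i)) : Prop :=
  IsLongNearPrism ℓ a b P ∧
  ∀ (a' b' : Fin 3 → V) (P' : ∀ i : Fin 3, G.Walk (a' i) (b' i)),
    IsLongNearPrism ℓ a' b' P' → (prismSupport P).ncard ≤ (prismSupport P').ncard

/-- The interior `F_K*` of the frame of a long near-prism: for each constituent path,
either the whole path (if it has length at most `ℓ-1`), or the non-end vertices of the
two stubs of length `ℓ/2 - 1` at its two ends. -/
def frameStar (ℓ : ℕ) {G : SimpleGraph V} {a b : Fin 3 → V}
    (P : ∀ i : Fin 3, G.Walk (a i) (b i)) : Set V :=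
  ⋃ i,
    if (P i).length ≤ ℓ - 1 then vset (P i)
    else {x | x ∈ (P i).support.take (ℓ / 2 - 1)} ∪
      {x | x ∈ (P i).support.reverse.take (ℓ / 2 - 1)}

/-- A long near-prism is tidy: it contains a frame (so at most one constituent path has
length at most `ℓ-1`) whose interior is anticomplete to the rest of the graph. -/
def Tidy (G : SimpleGraph V) (ℓ : ℕ) {a b : Fin 3 → V}
    (P : ∀ i : Fin 3, G.Walk (a i) (b i)) : Prop :=
  (∀ i j, (P i).length ≤ ℓ - 1 → (P j).length ≤ ℓ - 1 → i = j) ∧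
  Anticomplete G (frameStar ℓ P) {x | x ∉ prismSupport P}

/-- The index of the first neighbour of `x` in the list `l`. -/
noncomputable def firstNbrIdx (G : SimpleGraph V) (l : List V) (x : V) : ℕ :=
  l.findIdx (fun y => decide (G.Adj x y))

/-- `α(x)`: the neighbour of `x` on `P` nearest to the first end of `P`. -/
noncomputable def alpha (G : SimpleGraph V) {u w : V} (P : G.Walk u w) (x : V) : V :=
  P.support.getD (firstNbrIdx G P.support x) u

/-- `β(x)`: the neighbour of `x` on `P` nearest to the last end of `P`. -/
noncomputable def beta (G : SimpleGraph V) {u w : V} (P : G.Walk u w) (x : V) : V :=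
  P.support.reverse.getD (firstNbrIdx G P.support.reverse x) w

/-- `A(x)`: the vertex set of the subpath of `P` from its first end to `α(x)` if `x` has
a neighbour on `P`, and all of `V(P)` otherwise. -/
noncomputable def Aset (G : SimpleGraph V) {u w : V} (P : G.Walk u w) (x : V) : Set V :=
  if ∃ y ∈ P.support, G.Adj x y then
    {z | z ∈ P.support.take (firstNbrIdx G P.support x + 1)}
  else vset P

noncomputable def A123 (G : SimpleGraph V) {a b : Fin 3 → V}
    (P : ∀ i : Fin 3, G.Walk (a i) (b i)) (x : V) : Set V :=
  ⋃ i, Aset G (P i) x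

/-- The index of `v` in the list `l`. -/
noncomputable def listIdx (l : List V) (v : V) : ℕ :=
  l.findIdx (fun z => decide (z = v))

/-- `K^m_n(v)`: the union of the maximal subpath of `P` from `v` towards the first end of
`P` of length at most `m` with no internal vertex in `Fs`, and the maximal subpath of `P`
from `v` towards the last end of `P` of length at most `n` with no internal vertex in `Fs`. -/
noncomputable def Kmn (G : SimpleGraph V) (Fs : Set V) {u w : V}
    (P : G.Walk u w) (v : V) (m n : ℕ) : Set V :=
  let t := listIdx P.support v
  {z | ∃ r, r ≤ t ∧ t - r ≤ m ∧
      (∀ q, r < q → q < t → P.support.getD q v ∉ Fs) ∧ z = P.support.getD r v} ∪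
  {z | ∃ r, t ≤ r ∧ r < P.support.length ∧ r - t ≤ n ∧
      (∀ q, t < q → q < r → P.support.getD q v ∉ Fs) ∧ z = P.support.getD r v}

/-- `y` is distant from `x` (both `K`-major), for a tidy near-prism. -/
def Distant (G : SimpleGraph V) (ℓ : ℕ) {a b : Fin 3 → V}
    (P : ∀ i : Fin 3, G.Walk (a i) (b i)) (x y : V) : Prop :=
  ¬ G.Adj x y ∧
  (∃ z ∈ A123 G P x, G.Adj y z) ∧
  (∀ i, (∃ z ∈ (P i).support, G.Adj x z) →
    ∀ z ∈ Kmn G (frameStar ℓ P) (P i) (alpha G (P i) x) (ℓ - 2) 1, ¬ G.Adj y z) ∧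
  (∀ i, (¬ ∃ z ∈ (P i).support, G.Adj x z) →
    ∃ j, j ≠ i ∧
      ∀ z ∈ Kmn G (frameStar ℓ P) (P j) (beta G (P j) x) 0 (ℓ - 3), ¬ G.Adj y z)

/-- The hole `c`, regarded as a graph on `V`. -/
def holeGraph (G : SimpleGraph V) {u : V} (c : G.Walk u u) : SimpleGraph V :=
  SimpleGraph.fromEdgeSet {e | e ∈ c.edges}

/-- The distance between two vertices in the hole `c`. -/
noncomputable def holeDist (G : SimpleGraph V) {u : V} (c : G.Walk u u) (x y : V) : ℕ :=
  (holeGraph G c).dist x y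

/-- `x` is `C`-major for the hole `c`: `x` is not on `c` and no path of `c` with at most
three vertices contains all neighbours of `x` on `c`. -/
def CMajor (G : SimpleGraph V) {u : V} (c : G.Walk u u) (x : V) : Prop :=
  x ∉ c.support ∧
  ¬ ∃ q ∈ c.support, ∀ z ∈ c.support, G.Adj x z → z = q ∨ s(q, z) ∈ c.edges

/-- A shortest long even hole. -/
def ShortestLEH (G : SimpleGraph V) (ℓ : ℕ) {u : V} (c : G.Walk u u) : Prop :=
  IsLongEvenHole ℓ c ∧
  ∀ (v : V) (c' : G.Walk v v), IsLongEvenHole ℓ c' → c.length ≤ c'.length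

/-- `L₁, L₂` are the two `x y`-paths of the hole `c`. -/
def ArcPair {G : SimpleGraph V} {u : V} (c : G.Walk u u) {x y : V}
    (L₁ L₂ : G.Walk x y) : Prop :=
  L₁.IsPath ∧ L₂.IsPath ∧
  (∀ e ∈ L₁.edges, e ∈ c.edges) ∧ (∀ e ∈ L₂.edges, e ∈ c.edges) ∧
  (∀ e ∈ c.edges, e ∈ L₁.edges ∨ e ∈ L₂.edges) ∧
  (∀ e ∈ L₁.edges, e ∉ L₂.edges)

/-- `X` is lighter than `Y`, with respect to the linear order on edges given by `idx`. -/
def Lighter [DecidableEq V] (idx : Sym2 V → ℕ) (X Y : Finset (Sym2 V)) : Prop :=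
  X.card < Y.card ∨
  (X.card = Y.card ∧ ∃ e ∈ Y, e ∉ X ∧
    ∀ f : Sym2 V, ((f ∈ X ∧ f ∉ Y) ∨ (f ∈ Y ∧ f ∉ X)) → idx e ≤ idx f)

/-- The lightest long even hole. -/
def LightestLEH [DecidableEq V] (G : SimpleGraph V) (ℓ : ℕ) (idx : Sym2 V → ℕ)
    {u : V} (c : G.Walk u u) : Prop :=
  IsLongEvenHole ℓ c ∧
  ∀ (v : V) (c' : G.Walk v v), IsLongEvenHole ℓ c' →
    c'.edges.toFinset ≠ c.edges.toFinset →
    Lighter idx c.edges.toFinset c'.edges.toFinset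

/-- A `(C,x)`-gap: a path of the hole `c` of length at least two whose ends are adjacent
to `x` and none of whose interior vertices is adjacent to `x`. -/
def IsGap (G : SimpleGraph V) {u : V} (c : G.Walk u u) (x : V) {p₁ p₂ : V}
    (P : G.Walk p₁ p₂) : Prop :=
  P.IsPath ∧ (∀ e ∈ P.edges, e ∈ c.edges) ∧ 2 ≤ P.length ∧
  G.Adj x p₁ ∧ G.Adj x p₂ ∧ ∀ z ∈ inter P, ¬ G.Adj x z

end LEH

namespace LEH

variable {V : Type*} {G : SimpleGraph V}

/-- There is an induced path of `G` from `u` to `v` with vertex set `S` and length `n`. -/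
def IndPath (G : SimpleGraph V) (u v : V) (S : Set V) (n : ℕ) : Prop :=
  ∃ W : G.Walk u v, IsInducedPath W ∧ vset W = S ∧ W.length = n

namespace IndPath

variable {u v u' v' : V} {S T : Set V} {n m : ℕ}

theorem singleton (v : V) : IndPath G v v {v} 0 := by
  refine ⟨Walk.nil, ⟨by simp, ?_⟩, ?_, rfl⟩
  · intro x hx y hy h
    simp only [Walk.support_nil, List.mem_singleton] at hx hy
    subst hx hy
    exact (G.loopless.irrefl _ h).elim
  · ext; simp [vset]

theorem symm (h : IndPath G u v S n) : IndPath G v u S n := by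
  obtain ⟨W, ⟨hp, hi⟩, rfl, rfl⟩ := h
  refine ⟨W.reverse, ⟨hp.reverse, ?_⟩, ?_, W.length_reverse⟩
  · intro x hx y hy hxy
    simp only [Walk.support_reverse, List.mem_reverse, Walk.edges_reverse] at hx hy ⊢
    exact hi x hx y hy hxy
  · ext; simp [vset]

theorem glue (h : IndPath G u v S n) (h' : IndPath G u' v' T m) (huv : G.Adj v u')
    (hc : ∀ s ∈ S, ∀ t ∈ T, s ≠ t ∧ (G.Adj s t → s = v ∧ t = u')) :
    IndPath G u v' (S ∪ T) (n + m + 1) := by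
  obtain ⟨P, ⟨hp, hi⟩, rfl, rfl⟩ := h
  obtain ⟨Q, ⟨hq, hj⟩, rfl, rfl⟩ := h'
  have hsupp : (P.append (Walk.cons huv Q)).support = P.support ++ Q.support := by
    simp [Walk.support_append]
  refine ⟨P.append (Walk.cons huv Q), ⟨?_, ?_⟩, ?_, ?_⟩
  · rw [Walk.isPath_def, hsupp, List.nodup_append]
    exact ⟨hp.support_nodup, hq.support_nodup, fun a ha b hb => (hc a ha b hb).1⟩
  · intro x hx y hy hxy
    rw [hsupp, List.mem_append] at hx hy
    simp only [Walk.edges_append, Walk.edges_cons, List.mem_append, List.mem_cons]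
    rcases hx with hx | hx <;> rcases hy with hy | hy
    · exact Or.inl (hi x hx y hy hxy)
    · obtain ⟨rfl, rfl⟩ := (hc x hx y hy).2 hxy
      exact Or.inr (Or.inl rfl)
    · obtain ⟨rfl, rfl⟩ := (hc y hy x hx).2 hxy.symm
      exact Or.inr (Or.inl Sym2.eq_swap)
    · exact Or.inr (Or.inr (hj x hx y hy hxy))
  · ext z
    simp only [vset, hsupp, List.mem_append, Set.mem_ofPred_eq, Set.mem_union]
  · simp only [Walk.length_append, Walk.length_cons]
    omega

end IndPath

/-- Three pairwise anticomplete induced paths between nonadjacent vertices form a long theta. -/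
theorem hasLongTheta_of_indPath {ℓ : ℕ} {u v : V} {S₁ S₂ S₃ : Set V} {n₁ n₂ n₃ : ℕ}
    (h₁ : IndPath G u v S₁ n₁) (h₂ : IndPath G u v S₂ n₂) (h₃ : IndPath G u v S₃ n₃)
    (huv : u ≠ v) (hadj : ¬ G.Adj u v)
    (h₁₂ : Anticomplete G (S₁ \ {u, v}) (S₂ \ {u, v}))
    (h₁₃ : Anticomplete G (S₁ \ {u, v}) (S₃ \ {u, v}))
    (h₂₃ : Anticomplete G (S₂ \ {u, v}) (S₃ \ {u, v}))
    (l₁₂ : ℓ ≤ n₁ + n₂) (l₁₃ : ℓ ≤ n₁ + n₃) (l₂₃ : ℓ ≤ n₂ + n₃) : HasLongTheta G ℓ := by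
  obtain ⟨P₁, i₁, rfl, rfl⟩ := h₁
  obtain ⟨P₂, i₂, rfl, rfl⟩ := h₂
  obtain ⟨P₃, i₃, rfl, rfl⟩ := h₃
  have key : ∀ W : G.Walk u v, inter W = vset W \ {u, v} := by
    intro W
    ext z
    simp [inter, vset]
  refine ⟨u, v, P₁, P₂, P₃, huv, hadj, i₁, i₂, i₃, ?_, ?_, ?_, l₁₂, l₁₃, l₂₃⟩ <;>
    simpa only [key]

theorem isLongHoleOn_of_indPath {ℓ : ℕ} {a b a' b' : V} {S T : Set V} {n m : ℕ}
    (h : IndPath G a b S n) (h' : IndPath G a' b' T m) (ha : G.Adj a a') (hb : G.Adj b b')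
    (hc : ∀ s ∈ S, ∀ t ∈ T, s ≠ t ∧ (G.Adj s t → (s = a ∧ t = a') ∨ (s = b ∧ t = b')))
    (hnm : 4 ≤ n + m) (hℓ : ℓ ≤ n + m + 2) : IsLongHoleOn G ℓ (S ∪ T) := by
  obtain ⟨P, ⟨hp, hi⟩, rfl, rfl⟩ := h
  obtain ⟨Q, ⟨hq, hj⟩, rfl, rfl⟩ := h'.symm
  set W := P.append (Walk.cons hb Q) with hW
  have hsupp : W.support = P.support ++ Q.support := by
    simp [hW, Walk.support_append]
  have hedge : W.edges = P.edges ++ s(b, b') :: Q.edges := by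
    simp [hW, Walk.edges_append]
  have hlen : W.length = P.length + Q.length + 1 := by
    simp only [hW, Walk.length_append, Walk.length_cons]
    omega
  have hWp : W.IsPath := by
    rw [Walk.isPath_def, hsupp, List.nodup_append]
    exact ⟨hp.support_nodup, hq.support_nodup, fun a ha b hb => (hc a ha b hb).1⟩
  have hnot : s(a', a) ∉ W.edges := by
    rw [hedge, List.mem_append, List.mem_cons]
    rintro (he | he | he)
    · exact (hc a' (P.fst_mem_support_of_mem_edges he) a' Q.end_mem_support).1 rfl
    · rw [Sym2.eq_iff] at he
      rcases he with ⟨h1, h2⟩ | ⟨h1, h2⟩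
      · exact (hc b P.end_mem_support a' Q.end_mem_support).1 h1.symm
      · subst h1 h2
        have h3 := Walk.length_eq_zero_iff.2 (Walk.isPath_iff_nil.1 hp)
        have h4 := Walk.length_eq_zero_iff.2 (Walk.isPath_iff_nil.1 hq)
        omega
    · exact (hc a P.start_mem_support a (Q.snd_mem_support_of_mem_edges he)).1 rfl
  have hcs : ∀ z, z ∈ (Walk.cons ha.symm W).support ↔ z ∈ P.support ∨ z ∈ Q.support := by
    intro z
    rw [Walk.support_cons, List.mem_cons, hsupp, List.mem_append]
    constructor
    · rintro (rfl | h)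
      · exact Or.inr Q.end_mem_support
      · exact h
    · exact Or.inr
  refine ⟨a', Walk.cons ha.symm W, ⟨?_, ?_, ?_⟩, ?_, ?_⟩
  · exact (Walk.cons_isCycle_iff W ha.symm).2 ⟨hWp, hnot⟩
  · rw [Walk.length_cons]
    omega
  · intro x hx y hy hxy
    rw [hcs] at hx hy
    rw [Walk.edges_cons, hedge, List.mem_cons, List.mem_append, List.mem_cons]
    rcases hx with hx | hx <;> rcases hy with hy | hy
    · exact Or.inr (Or.inl (hi x hx y hy hxy))
    · rcases (hc x hx y hy).2 hxy with ⟨rfl, rfl⟩ | ⟨rfl, rfl⟩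
      · exact Or.inl Sym2.eq_swap
      · exact Or.inr (Or.inr (Or.inl rfl))
    · rcases (hc y hy x hx).2 hxy.symm with ⟨rfl, rfl⟩ | ⟨rfl, rfl⟩
      · exact Or.inl rfl
      · exact Or.inr (Or.inr (Or.inl Sym2.eq_swap))
    · exact Or.inr (Or.inr (Or.inr (hj x hx y hy hxy)))
  · rw [Walk.length_cons]
    omega
  · ext z
    exact hcs z

/-- `S` and `T` are disjoint, and the only edges between them are `aa'` and `bb'`. -/
structure PrismJoin (G : SimpleGraph V) (a b : V) (S : Set V) (a' b' : V) (T : Set V) : Prop where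
  left : G.Adj a a'
  right : G.Adj b b'
  cross : ∀ s ∈ S, ∀ t ∈ T, s ≠ t ∧ (G.Adj s t → (s = a ∧ t = a') ∨ (s = b ∧ t = b'))

theorem PrismJoin.symm {a b a' b' : V} {S T : Set V} (h : PrismJoin G a b S a' b' T) :
    PrismJoin G a' b' T a b S :=
  ⟨h.left.symm, h.right.symm, fun s hs t ht => ⟨(h.cross t ht s hs).1.symm, fun hst =>
    ((h.cross t ht s hs).2 hst.symm).imp And.symm And.symm⟩⟩

theorem exists_isLongNearPrism {ℓ : ℕ} (hℓ : 6 ≤ ℓ) {a b : Fin 3 → V} {S : Fin 3 → Set V}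
    {n : Fin 3 → ℕ} (hp : ∀ i, IndPath G (a i) (b i) (S i) (n i))
    (hj : ∀ i j, i ≠ j → PrismJoin G (a i) (b i) (S i) (a j) (b j) (S j))
    (hn : ∀ i j, i ≠ j → ℓ ≤ n i + n j + 2) :
    ∃ P : ∀ i, G.Walk (a i) (b i), IsLongNearPrism ℓ a b P ∧ prismSupport P = ⋃ i, S i := by
  choose P hP hS hl using hp
  have hmem : ∀ i z, z ∈ (P i).support ↔ z ∈ S i := by
    intro i z
    rw [← hS i]
    rfl
  have hdis : ∀ i j, a i = b j → i = j := by
    intro i j h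
    by_contra hij
    exact ((hj i j hij).cross (a i) ((hmem _ _).1 (P i).start_mem_support) (b j)
      ((hmem _ _).1 (P j).end_mem_support)).1 h
  have hzero : ∀ i, a i = b i → n i = 0 := by
    intro i h
    rw [← hl i]
    have key : ∀ (u v : V) (W : G.Walk u v), W.IsPath → u = v → W.length = 0 := by
      rintro u v W hW rfl
      exact Walk.length_eq_zero_iff.2 (Walk.isPath_iff_nil.1 hW)
    exact key _ _ _ (hP i).1 h
  refine ⟨P, ⟨fun i j h => (hj i j h).left, fun i j h => (hj i j h).right, ?_,
    fun i => (hP i).1, ?_, ?_⟩, ?_⟩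
  · rintro x ⟨⟨i, rfl⟩, ⟨j, hj'⟩⟩ y ⟨⟨i', rfl⟩, ⟨j', hj''⟩⟩
    obtain rfl := hdis _ _ hj'.symm
    obtain rfl := hdis _ _ hj''.symm
    by_contra hne
    have hii : i ≠ i' := fun h => hne (by rw [h])
    have := hn i i' hii
    rw [hzero i hj'.symm, hzero i' hj''.symm] at this
    omega
  · intro i j hij x hx hx'
    exact ((hj i j hij).cross x ((hmem _ _).1 hx) x ((hmem _ _).1 hx')).1 rfl
  · intro i j hij
    rw [hS i, hS j]
    have := hn i j hij
    exact isLongHoleOn_of_indPath ⟨P i, hP i, hS i, hl i⟩ ⟨P j, hP j, hS j, hl j⟩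
      (hj i j hij).left (hj i j hij).right (hj i j hij).cross (by omega) this
  · simp only [prismSupport, hS]

theorem exists_isLongNearPrism_three {ℓ : ℕ} (hℓ : 6 ≤ ℓ) {a₀ a₁ a₂ b₀ b₁ b₂ : V}
    {S₀ S₁ S₂ : Set V} {n₀ n₁ n₂ : ℕ} (h₀ : IndPath G a₀ b₀ S₀ n₀) (h₁ : IndPath G a₁ b₁ S₁ n₁)
    (h₂ : IndPath G a₂ b₂ S₂ n₂) (h₀₁ : PrismJoin G a₀ b₀ S₀ a₁ b₁ S₁)
    (h₀₂ : PrismJoin G a₀ b₀ S₀ a₂ b₂ S₂) (h₁₂ : PrismJoin G a₁ b₁ S₁ a₂ b₂ S₂)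
    (l₀₁ : ℓ ≤ n₀ + n₁ + 2) (l₀₂ : ℓ ≤ n₀ + n₂ + 2) (l₁₂ : ℓ ≤ n₁ + n₂ + 2) :
    ∃ (a b : Fin 3 → V) (P : ∀ i, G.Walk (a i) (b i)),
      IsLongNearPrism ℓ a b P ∧ prismSupport P = S₀ ∪ S₁ ∪ S₂ := by
  have key := exists_isLongNearPrism (G := G) hℓ (a := ![a₀, a₁, a₂]) (b := ![b₀, b₁, b₂])
    (S := ![S₀, S₁, S₂]) (n := ![n₀, n₁, n₂]) ?_ ?_ ?_
  · obtain ⟨P, hP, hS⟩ := key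
    refine ⟨_, _, P, hP, hS.trans ?_⟩
    ext z
    simp [Fin.exists_fin_succ, or_assoc]
  · intro i
    fin_cases i
    exacts [h₀, h₁, h₂]
  · intro i j hij
    fin_cases i <;> fin_cases j
    exacts [(hij rfl).elim, h₀₁, h₀₂, h₀₁.symm, (hij rfl).elim, h₁₂, h₀₂.symm, h₁₂.symm,
      (hij rfl).elim]
  · intro i j hij
    fin_cases i <;> fin_cases j <;> simp at hij ⊢ <;> omega

/-- The vertices `f 0, …, f n` form an induced path, in this order. -/
structure IsIndSeq (G : SimpleGraph V) (f : ℕ → V) (n : ℕ) : Prop where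
  adj : ∀ {s t}, s ≤ n → t ≤ n → (G.Adj (f s) (f t) ↔ s + 1 = t ∨ t + 1 = s)
  inj : ∀ {s t}, s ≤ n → t ≤ n → f s = f t → s = t

theorem IsIndSeq.indPath {f : ℕ → V} {n : ℕ} (h : IsIndSeq G f n) {s t : ℕ} (hst : s ≤ t)
    (ht : t ≤ n) : IndPath G (f s) (f t) (f '' Set.Icc s t) (t - s) := by
  induction t, hst using Nat.le_induction with
  | base =>
    simpa using IndPath.singleton (G := G) (f s)
  | succ t hst ih =>
    have h1 := (ih (by omega)).glue (IndPath.singleton (f (t + 1)))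
      ((h.adj (by omega) ht).2 (Or.inl rfl)) ?_
    · have h2 : f '' Set.Icc s t ∪ {f (t + 1)} = f '' Set.Icc s (t + 1) := by
        rw [← Set.image_singleton, ← Set.image_union]
        congr 1
        ext r
        simp only [Set.mem_union, Set.mem_Icc, Set.mem_singleton_iff]
        omega
      have h3 : t - s + 0 + 1 = t + 1 - s := by omega
      rwa [h2, h3] at h1
    · rintro _ ⟨r, ⟨hr, hr'⟩, rfl⟩ _ rfl
      refine ⟨fun he => ?_, fun he => ⟨?_, rfl⟩⟩
      · have := h.inj (by omega) ht he
        omega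
      · have := (h.adj (by omega) ht).1 he
        congr 1
        omega

/-- The sequences `f i` are the constituent paths of a near-prism. -/
structure IsPrismSeq (G : SimpleGraph V) (f : Fin 3 → ℕ → V) (n : Fin 3 → ℕ) : Prop where
  seq : ∀ i, IsIndSeq G (f i) (n i)
  ne : ∀ {i j}, i ≠ j → ∀ {s t}, s ≤ n i → t ≤ n j → f i s ≠ f j t
  adj : ∀ {i j}, i ≠ j → ∀ {s t}, s ≤ n i → t ≤ n j →
    (G.Adj (f i s) (f j t) ↔ (s = 0 ∧ t = 0) ∨ (s = n i ∧ t = n j))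

theorem IsLongHoleOn.eq_of_adj {ℓ : ℕ} {S : Set V} (h : IsLongHoleOn G ℓ S) {v u₁ u₂ u₃ : V}
    (hv : v ∈ S) (h₁ : u₁ ∈ S) (h₂ : u₂ ∈ S) (h₃ : u₃ ∈ S) (a₁ : G.Adj v u₁) (a₂ : G.Adj v u₂)
    (a₃ : G.Adj v u₃) : u₁ = u₂ ∨ u₁ = u₃ ∨ u₂ = u₃ := by
  obtain ⟨w, c, ⟨hc, -, hi⟩, -, rfl⟩ := h
  have hcard := hc.ncard_neighborSet_toSubgraph_eq_two hv
  have hmem : ∀ u ∈ c.support, G.Adj v u → u ∈ c.toSubgraph.neighborSet v := by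
    intro u hu hvu
    rw [Subgraph.mem_neighborSet, ← Subgraph.mem_edgeSet, Walk.mem_edges_toSubgraph]
    exact hi v hv u hu hvu
  by_contra hcon
  push Not at hcon
  obtain ⟨p, q, -, hpq⟩ := Set.ncard_eq_two.1 hcard
  have k₁ := hmem _ h₁ a₁
  have k₂ := hmem _ h₂ a₂
  have k₃ := hmem _ h₃ a₃
  rw [hpq] at k₁ k₂ k₃
  simp only [Set.mem_insert_iff, Set.mem_singleton_iff] at k₁ k₂ k₃
  grind

theorem IsLongNearPrism.isPrismSeq {ℓ : ℕ} {a b : Fin 3 → V} {P : ∀ i, G.Walk (a i) (b i)}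
    (h : IsLongNearPrism ℓ a b P) :
    IsPrismSeq G (fun i => (P i).getVert) (fun i => (P i).length) := by
  obtain ⟨ha, hb, hab, hp, hd, hh⟩ := h
  have hinj : ∀ i {s t}, s ≤ (P i).length → t ≤ (P i).length →
      (P i).getVert s = (P i).getVert t → s = t := fun i s t hs ht he =>
    (hp i).getVert_injOn hs ht he
  have hmem : ∀ i t, (P i).getVert t ∈ (P i).support := fun i t => (P i).getVert_mem_support t
  have hne : ∀ i j, i ≠ j → ∀ s t, (P i).getVert s ≠ (P j).getVert t := by
    intro i j hij s t he
    exact hd i j hij _ (hmem i s) (he ▸ hmem j t)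
  have hsucc : ∀ i {t}, t + 1 ≤ (P i).length →
      G.Adj ((P i).getVert t) ((P i).getVert (t + 1)) := fun i t ht =>
    (P i).adj_getVert_succ (by omega)
  have hz : ∀ i j, i ≠ j → G.Adj ((P i).getVert 0) ((P j).getVert 0) := by
    intro i j hij
    simpa using ha i j hij
  have hl : ∀ i j, i ≠ j → G.Adj ((P i).getVert (P i).length) ((P j).getVert (P j).length) := by
    intro i j hij
    simpa using hb i j hij
  have three : ∀ i j, i ≠ j → ∀ s {u₁ u₂ u₃ : V},
      (u₁ ∈ (P i).support ∨ u₁ ∈ (P j).support) → (u₂ ∈ (P i).support ∨ u₂ ∈ (P j).support) →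
      (u₃ ∈ (P i).support ∨ u₃ ∈ (P j).support) → G.Adj ((P i).getVert s) u₁ →
      G.Adj ((P i).getVert s) u₂ → G.Adj ((P i).getVert s) u₃ →
      u₁ = u₂ ∨ u₁ = u₃ ∨ u₂ = u₃ := by
    intro i j hij s u₁ u₂ u₃ h₁ h₂ h₃
    exact (hh i j hij).eq_of_adj (Or.inl (hmem i s)) h₁ h₂ h₃
  have hcons : ∀ i {s t}, s ≤ (P i).length → t ≤ (P i).length →
      G.Adj ((P i).getVert s) ((P i).getVert t) → s + 1 = t ∨ t + 1 = s := by
    intro i s t hs ht hst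
    have hst' : s ≠ t := by
      rintro rfl
      exact G.loopless.irrefl _ hst
    obtain ⟨j, hij⟩ : ∃ j, i ≠ j := ⟨i + 1, by fin_cases i <;> decide⟩
    by_contra hcon
    push Not at hcon
    rcases Nat.eq_zero_or_pos s with rfl | hs0
    · rcases three i j hij 0 (Or.inl (hmem i t)) (Or.inl (hmem i 1)) (Or.inr (hmem j 0)) hst
        (hsucc i (by omega)) (hz i j hij) with e | e | e
      · have := hinj i ht (by omega) e
        omega
      · exact hne i j hij _ _ e
      · exact hne i j hij _ _ e
    · have hpred := (hsucc i (t := s - 1) (by omega)).symm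
      rw [Nat.sub_add_cancel hs0] at hpred
      rcases eq_or_lt_of_le hs with rfl | hsl
      · rcases three i j hij _ (Or.inl (hmem i t)) (Or.inl (hmem i _)) (Or.inr (hmem j _)) hst
          hpred (hl i j hij) with e | e | e
        · have := hinj i ht (by omega) e
          omega
        · exact hne i j hij _ _ e
        · exact hne i j hij _ _ e
      · rcases three i j hij _ (Or.inl (hmem i t)) (Or.inl (hmem i _)) (Or.inl (hmem i _)) hst
          hpred (hsucc i hsl) with e | e | e
        · have := hinj i ht (by omega) e
          omega
        · have := hinj i ht (by omega) e
          omega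
        · have := hinj i (by omega) (by omega) e
          omega
  refine ⟨fun i => ⟨fun hs ht => ⟨hcons i hs ht, ?_⟩, fun hs ht => hinj i hs ht⟩,
    fun hij s t _ _ => hne _ _ hij s t, ?_⟩
  · rintro (rfl | rfl)
    · exact hsucc i ht
    · exact (hsucc i hs).symm
  · intro i j hij s t hs ht
    refine ⟨fun hst => ?_, ?_⟩
    · by_cases hs0 : s = 0
      · subst hs0
        by_cases hn : (P i).length = 0
        · rcases three i j hij 0 (Or.inr (hmem j t)) (Or.inr (hmem j 0))
            (Or.inr (hmem j (P j).length)) hst (hz i j hij)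
            (by have := hl i j hij; rwa [hn] at this) with e | e | e
          · exact Or.inl ⟨rfl, hinj j ht (by omega) e⟩
          · exact Or.inr ⟨hn.symm, hinj j ht le_rfl e⟩
          · have h0 := hinj j (by omega) le_rfl e
            exact Or.inl ⟨rfl, by omega⟩
        · rcases three i j hij 0 (Or.inr (hmem j t)) (Or.inr (hmem j 0)) (Or.inl (hmem i 1)) hst
            (hz i j hij) (hsucc i (by omega)) with e | e | e
          · exact Or.inl ⟨rfl, hinj j ht (by omega) e⟩
          · exact (hne i j hij _ _ e.symm).elim
          · exact (hne i j hij _ _ e.symm).elim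
      · have hpred := (hsucc i (t := s - 1) (by omega)).symm
        rw [Nat.sub_add_cancel (by omega)] at hpred
        rcases eq_or_lt_of_le hs with rfl | hsl
        · rcases three i j hij _ (Or.inr (hmem j t)) (Or.inr (hmem j (P j).length))
            (Or.inl (hmem i _)) hst (hl i j hij) hpred with e | e | e
          · exact Or.inr ⟨rfl, hinj j ht le_rfl e⟩
          · exact (hne i j hij _ _ e.symm).elim
          · exact (hne i j hij _ _ e.symm).elim
        · rcases three i j hij _ (Or.inr (hmem j t)) (Or.inl (hmem i _)) (Or.inl (hmem i _)) hst
            hpred (hsucc i hsl) with e | e | e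
          · exact (hne i j hij _ _ e.symm).elim
          · exact (hne i j hij _ _ e.symm).elim
          · have := hinj i (by omega) (by omega) e
            omega
    · rintro (⟨rfl, rfl⟩ | ⟨rfl, rfl⟩)
      · exact hz i j hij
      · exact hl i j hij

theorem IsPrismSeq.prismJoin {f : Fin 3 → ℕ → V} {n : Fin 3 → ℕ} (h : IsPrismSeq G f n)
    {i j : Fin 3} (hij : i ≠ j) {S T : Set V} {q : V}
    (hS : ∀ z ∈ S, z = q ∨ ∃ u ≤ n i, z = f i u) (hT : ∀ z ∈ T, ∃ u ≤ n j, z = f j u)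
    (hq : ∀ u ≤ n j, q ≠ f j u ∧ ¬ G.Adj q (f j u)) :
    PrismJoin G (f i 0) (f i (n i)) S (f j 0) (f j (n j)) T := by
  refine ⟨(h.adj hij (by omega) (by omega)).2 (Or.inl ⟨rfl, rfl⟩),
    (h.adj hij le_rfl le_rfl).2 (Or.inr ⟨rfl, rfl⟩), fun z hz w hw => ?_⟩
  obtain ⟨u', hu', rfl⟩ := hT w hw
  rcases hS z hz with rfl | ⟨u, hu, rfl⟩
  · exact ⟨(hq u' hu').1, fun ha => ((hq u' hu').2 ha).elim⟩
  · refine ⟨h.ne hij hu hu', fun ha => ?_⟩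
    rcases (h.adj hij hu hu').1 ha with ⟨rfl, rfl⟩ | ⟨rfl, rfl⟩
    · exact Or.inl ⟨rfl, rfl⟩
    · exact Or.inr ⟨rfl, rfl⟩

theorem ShortestLNP.not_three [Finite V] {ℓ : ℕ} (hℓ : 6 ≤ ℓ) {a b : Fin 3 → V}
    {P : ∀ i, G.Walk (a i) (b i)} (hsh : ShortestLNP G ℓ P) {a₀ a₁ a₂ b₀ b₁ b₂ : V}
    {S₀ S₁ S₂ : Set V} {n₀ n₁ n₂ : ℕ} (h₀ : IndPath G a₀ b₀ S₀ n₀) (h₁ : IndPath G a₁ b₁ S₁ n₁)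
    (h₂ : IndPath G a₂ b₂ S₂ n₂) (h₀₁ : PrismJoin G a₀ b₀ S₀ a₁ b₁ S₁)
    (h₀₂ : PrismJoin G a₀ b₀ S₀ a₂ b₂ S₂) (h₁₂ : PrismJoin G a₁ b₁ S₁ a₂ b₂ S₂)
    (l₀₁ : ℓ ≤ n₀ + n₁ + 2) (l₀₂ : ℓ ≤ n₀ + n₂ + 2) (l₁₂ : ℓ ≤ n₁ + n₂ + 2)
    {q c d : V} (hc : c ∈ prismSupport P) (hd : d ∈ prismSupport P) (hcd : c ≠ d)
    (hsub : S₀ ∪ S₁ ∪ S₂ ⊆ insert q (prismSupport P \ {c, d})) : False := by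
  obtain ⟨a', b', P', hP', hS⟩ := exists_isLongNearPrism_three hℓ h₀ h₁ h₂ h₀₁ h₀₂ h₁₂ l₀₁ l₀₂ l₁₂
  have h1 := hsh.2 a' b' P' hP'
  rw [hS] at h1
  have h2 := Set.ncard_le_ncard hsub (Set.toFinite _)
  have h3 := Set.ncard_insert_le q (prismSupport P \ {c, d})
  have hss : ({c, d} : Set V) ⊆ prismSupport P := by
    rintro z (rfl | rfl)
    exacts [hc, hd]
  have h4 := Set.ncard_sdiff_add_ncard_of_subset hss (Set.toFinite _)
  rw [Set.ncard_pair hcd] at h4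
  omega

theorem mem_prismSupport {a b : Fin 3 → V} {P : ∀ i, G.Walk (a i) (b i)} {z : V} :
    z ∈ prismSupport P ↔ ∃ i, ∃ t ≤ (P i).length, z = (P i).getVert t := by
  simp only [prismSupport, vset, Set.mem_iUnion, Set.mem_ofPred_eq,
    Walk.mem_support_iff_exists_getVert]
  exact exists_congr fun i => ⟨fun ⟨t, h, ht⟩ => ⟨t, ht, h.symm⟩, fun ⟨t, ht, h⟩ => ⟨t, h.symm, ht⟩⟩

/-- The vertex `x` is not on the paths `f i`, and its neighbours there have distance at least `m`
from the ends. -/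
structure IsCentral (G : SimpleGraph V) (f : Fin 3 → ℕ → V) (n : Fin 3 → ℕ) (m : ℕ) (x : V) :
    Prop where
  ne : ∀ i, ∀ t ≤ n i, x ≠ f i t
  bound : ∀ i, ∀ t ≤ n i, G.Adj x (f i t) → m ≤ t ∧ t + m ≤ n i

theorem ShortestLNP.not_shortcut [Finite V] {ℓ m : ℕ} (hℓ : 6 ≤ ℓ) {a b : Fin 3 → V}
    {P : ∀ i, G.Walk (a i) (b i)} (hsh : ShortestLNP G ℓ P) {f : Fin 3 → ℕ → V} {n : Fin 3 → ℕ}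
    (hK : ∀ z, z ∈ prismSupport P ↔ ∃ i, ∃ t ≤ n i, z = f i t) (hf : IsPrismSeq G f n)
    (hm : ℓ ≤ 2 * m + 2) {i j k : Fin 3} (hij : i ≠ j) (hik : i ≠ k) (hjk : j ≠ k)
    (hnij : ℓ ≤ n i + n j + 2) {q : V} (hq : IsCentral G f n m q)
    (hqi : ∀ u ≤ n i, ¬ G.Adj q (f i u)) (hqj : ∀ u ≤ n j, ¬ G.Adj q (f j u))
    {s t : ℕ} (hst : s + 3 ≤ t) (ht : t ≤ n k) (hs : G.Adj q (f k s)) (ht' : G.Adj q (f k t))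
    (hext : ∀ u ≤ n k, G.Adj q (f k u) → s ≤ u ∧ u ≤ t) : False := by
  have hbs := hq.bound k s (by omega) hs
  have hbt := hq.bound k t ht ht'
  have h1 := ((hf.seq k).indPath (Nat.zero_le s) (by omega)).glue (IndPath.singleton q) hs.symm
    (by
      rintro _ ⟨u, ⟨-, hu⟩, rfl⟩ _ rfl
      refine ⟨(hq.ne k u (by omega)).symm, fun ha => ⟨?_, rfl⟩⟩
      have := hext u (by omega) ha.symm
      congr 1
      omega)
  have h2 := h1.glue ((hf.seq k).indPath ht le_rfl) ht'
    (by
      rintro z (⟨u, ⟨-, hu⟩, rfl⟩ | rfl) _ ⟨w, ⟨hw, hw'⟩, rfl⟩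
      · refine ⟨fun he => ?_, fun ha => ?_⟩
        · have := (hf.seq k).inj (by omega) hw' he
          omega
        · have := ((hf.seq k).adj (by omega) hw').1 ha
          omega
      · refine ⟨hq.ne k w hw', fun ha => ⟨rfl, ?_⟩⟩
        have := hext w hw' ha
        congr 1
        omega)
  have hS : ∀ z ∈ f k '' Set.Icc 0 s ∪ {q} ∪ f k '' Set.Icc t (n k),
      z = q ∨ ∃ u ≤ n k, (u ≤ s ∨ t ≤ u) ∧ z = f k u := by
    rintro z ((⟨u, ⟨-, hu⟩, rfl⟩ | rfl) | ⟨u, ⟨hu, hu'⟩, rfl⟩)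
    · exact Or.inr ⟨u, by omega, Or.inl hu, rfl⟩
    · exact Or.inl rfl
    · exact Or.inr ⟨u, hu', Or.inr hu, rfl⟩
  have hT : ∀ i, ∀ z ∈ f i '' Set.Icc 0 (n i), ∃ u ≤ n i, z = f i u := by
    rintro i z ⟨u, ⟨-, hu⟩, rfl⟩
    exact ⟨u, hu, rfl⟩
  have hS' : ∀ z ∈ f k '' Set.Icc 0 s ∪ {q} ∪ f k '' Set.Icc t (n k),
      z = q ∨ ∃ u ≤ n k, z = f k u := fun z hz =>
    (hS z hz).imp_right fun ⟨u, hu, _, h⟩ => ⟨u, hu, h⟩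
  refine hsh.not_three hℓ h2 ((hf.seq i).indPath (Nat.zero_le _) le_rfl)
    ((hf.seq j).indPath (Nat.zero_le _) le_rfl)
    (hf.prismJoin hik.symm hS' (hT i) fun u hu => ⟨hq.ne i u hu, hqi u hu⟩)
    (hf.prismJoin hjk.symm hS' (hT j) fun u hu => ⟨hq.ne j u hu, hqj u hu⟩)
    (hf.prismJoin hij (fun z hz => Or.inr (hT i z hz)) (hT j) fun u hu => ⟨hq.ne j u hu, hqj u hu⟩)
    (by omega) (by omega) (by omega) (q := q) (c := f k (s + 1)) (d := f k (s + 2))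
    ((hK _).2 ⟨k, s + 1, by omega, rfl⟩) ((hK _).2 ⟨k, s + 2, by omega, rfl⟩)
    (fun he => ?_) ?_
  · have := (hf.seq k).inj (by omega) (by omega) he
    omega
  · have hother : ∀ i, i ≠ k → ∀ z ∈ f i '' Set.Icc 0 (n i),
        z ∈ insert q (prismSupport P \ {f k (s + 1), f k (s + 2)}) := by
      intro i hik z hz
      obtain ⟨u, hu, rfl⟩ := hT i z hz
      refine Or.inr ⟨(hK _).2 ⟨i, u, hu, rfl⟩, ?_⟩
      rintro (he | he)
      · exact hf.ne hik hu (by omega) he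
      · exact hf.ne hik hu (by omega) he
    rintro z ((hz | hz) | hz)
    · rcases hS z hz with rfl | ⟨u, hu, hu', rfl⟩
      · exact Or.inl rfl
      · refine Or.inr ⟨(hK _).2 ⟨k, u, hu, rfl⟩, ?_⟩
        rintro (he | he)
        · have := (hf.seq k).inj hu (by omega) he
          omega
        · have := (hf.seq k).inj hu (by omega) he
          omega
    · exact hother i hik z hz
    · exact hother j hjk z hz

theorem ShortestLNP.not_adjacent_pair [Finite V] {ℓ m : ℕ} (hℓ : 6 ≤ ℓ) {a b : Fin 3 → V}
    {P : ∀ i, G.Walk (a i) (b i)} (hsh : ShortestLNP G ℓ P) {f : Fin 3 → ℕ → V} {n : Fin 3 → ℕ}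
    (hK : ∀ z, z ∈ prismSupport P ↔ ∃ i, ∃ t ≤ n i, z = f i t) (hf : IsPrismSeq G f n)
    (hm : ℓ ≤ 2 * m + 2) {i j k : Fin 3} (hij : i ≠ j) (hik : i ≠ k) (hjk : j ≠ k)
    (hni : ℓ ≤ n i) {x : V} (hx : IsCentral G f n m x) (hxi : ∀ u ≤ n i, ¬ G.Adj x (f i u))
    {v r : ℕ} (hv : v + 1 ≤ n j) (hxv : G.Adj x (f j v)) (hxv' : G.Adj x (f j (v + 1)))
    (hext : ∀ u ≤ n j, G.Adj x (f j u) → v ≤ u ∧ u ≤ v + 1) (hr : r ≤ n k)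
    (hxr : G.Adj x (f k r)) (hmin : ∀ u ≤ n k, G.Adj x (f k u) → r ≤ u) : False := by
  have hbv := hx.bound j v (by omega) hxv
  have hbv' := hx.bound j _ hv hxv'
  have hbr := hx.bound k r hr hxr
  have h0 := (IndPath.singleton x).glue ((hf.seq k).indPath (Nat.zero_le r) hr).symm hxr
    (by
      rintro _ rfl _ ⟨u, ⟨-, hu⟩, rfl⟩
      refine ⟨hx.ne k u (by omega), fun ha => ⟨rfl, ?_⟩⟩
      have := hmin u (by omega) ha
      congr 1
      omega)
  have h1 := ((hf.seq j).indPath (Nat.zero_le v) (by omega)).symm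
  have h2 := ((hf.seq j).indPath hv le_rfl).glue
    ((hf.seq i).indPath (Nat.zero_le (n i)) le_rfl).symm
    ((hf.adj hij.symm le_rfl le_rfl).2 (Or.inr ⟨rfl, rfl⟩))
    (by
      rintro _ ⟨u, ⟨hu, hu'⟩, rfl⟩ _ ⟨w, ⟨-, hw⟩, rfl⟩
      refine ⟨hf.ne hij.symm hu' hw, fun ha => ?_⟩
      rcases (hf.adj hij.symm hu' hw).1 ha with ⟨rfl, rfl⟩ | ⟨rfl, rfl⟩
      · omega
      · exact ⟨rfl, rfl⟩)
  refine hsh.not_three hℓ h0 h1 h2 ⟨hxv, ?_, ?_⟩ ⟨hxv', ?_, ?_⟩ ⟨?_, ?_, ?_⟩ (by omega) (by omega)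
    (by omega) (q := x) (c := f k (n k)) (d := f k (n k - 1))
    ((hK _).2 ⟨k, n k, le_rfl, rfl⟩) ((hK _).2 ⟨k, n k - 1, by omega, rfl⟩)
    (fun he => ?_) ?_
  · exact (hf.adj hjk.symm (by omega) (by omega)).2 (Or.inl ⟨rfl, rfl⟩)
  · rintro z (rfl | ⟨u, ⟨-, hu⟩, rfl⟩) _ ⟨w, ⟨-, hw⟩, rfl⟩
    · refine ⟨hx.ne j w (by omega), fun ha => Or.inl ⟨rfl, ?_⟩⟩
      have := hext w (by omega) ha
      congr 1
      omega
    · refine ⟨hf.ne hjk.symm (by omega) (by omega), fun ha => ?_⟩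
      rcases (hf.adj hjk.symm (by omega) (by omega)).1 ha with ⟨rfl, rfl⟩ | ⟨h, h'⟩
      · exact Or.inr ⟨rfl, rfl⟩
      · omega
  · exact (hf.adj hik.symm (by omega) (by omega)).2 (Or.inl ⟨rfl, rfl⟩)
  · rintro z (rfl | ⟨u, ⟨-, hu⟩, rfl⟩) z' (⟨w, ⟨hw, hw'⟩, rfl⟩ | ⟨w, ⟨hw, hw'⟩, rfl⟩)
    · refine ⟨hx.ne j w hw', fun ha => Or.inl ⟨rfl, ?_⟩⟩
      have := hext w hw' ha
      congr 1
      omega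
    · exact ⟨hx.ne i w hw', fun ha => (hxi w hw' ha).elim⟩
    · refine ⟨hf.ne hjk.symm (by omega) hw', fun ha => ?_⟩
      have := (hf.adj hjk.symm (by omega) hw').1 ha
      omega
    · refine ⟨hf.ne hik.symm (by omega) hw', fun ha => ?_⟩
      rcases (hf.adj hik.symm (by omega) hw').1 ha with ⟨rfl, rfl⟩ | ⟨h, h'⟩
      · exact Or.inr ⟨rfl, rfl⟩
      · omega
  · exact ((hf.seq j).adj (by omega) hv).2 (Or.inl rfl)
  · exact (hf.adj hij.symm (by omega) (by omega)).2 (Or.inl ⟨rfl, rfl⟩)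
  · rintro _ ⟨u, ⟨-, hu⟩, rfl⟩ z' (⟨w, ⟨hw, hw'⟩, rfl⟩ | ⟨w, ⟨hw, hw'⟩, rfl⟩)
    · refine ⟨fun he => ?_, fun ha => Or.inl ?_⟩
      · have := (hf.seq j).inj (by omega) hw' he
        omega
      · have := ((hf.seq j).adj (by omega) hw').1 ha
        constructor <;> congr 1 <;> omega
    · refine ⟨hf.ne hij.symm (by omega) hw', fun ha => ?_⟩
      rcases (hf.adj hij.symm (by omega) hw').1 ha with ⟨rfl, rfl⟩ | ⟨h, h'⟩
      · exact Or.inr ⟨rfl, rfl⟩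
      · omega
  · have := (hf.seq k).inj le_rfl (by omega) he
    omega
  · have hmem : ∀ i', i' ≠ k → ∀ u ≤ n i',
        f i' u ∈ insert x (prismSupport P \ {f k (n k), f k (n k - 1)}) := by
      intro i' hik' u hu
      refine Or.inr ⟨(hK _).2 ⟨i', u, hu, rfl⟩, ?_⟩
      rintro (he | he)
      · exact hf.ne hik' hu le_rfl he
      · exact hf.ne hik' hu (by omega) he
    rintro z (((rfl | ⟨u, ⟨-, hu⟩, rfl⟩) | ⟨u, ⟨-, hu⟩, rfl⟩) |
      (⟨u, ⟨-, hu⟩, rfl⟩ | ⟨u, ⟨-, hu⟩, rfl⟩))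
    · exact Or.inl rfl
    · refine Or.inr ⟨(hK _).2 ⟨k, u, by omega, rfl⟩, ?_⟩
      rintro (he | he)
      · have := (hf.seq k).inj (by omega) le_rfl he
        omega
      · have := (hf.seq k).inj (by omega) (by omega) he
        omega
    · exact hmem j hjk u (by omega)
    · exact hmem j hjk u hu
    · exact hmem i hik u hu

theorem exists_extreme {p : ℕ → Prop} {n : ℕ} (h : ∃ t ≤ n, p t) :
    ∃ s t, s ≤ t ∧ t ≤ n ∧ p s ∧ p t ∧ ∀ u ≤ n, p u → s ≤ u ∧ u ≤ t := by
  classical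
  obtain ⟨r, hr, hpr⟩ := h
  have hne : ((Finset.range (n + 1)).filter p).Nonempty :=
    ⟨r, by simpa using ⟨by omega, hpr⟩⟩
  have h1 := Finset.min'_mem _ hne
  have h2 := Finset.max'_mem _ hne
  rw [Finset.mem_filter, Finset.mem_range] at h1 h2
  refine ⟨_, _, Finset.min'_le_max' _ hne, by omega, h1.2, h2.2, fun u hu hpu => ?_⟩
  have hmem : u ∈ (Finset.range (n + 1)).filter p := by simpa using ⟨by omega, hpu⟩
  exact ⟨Finset.min'_le _ _ hmem, Finset.le_max' _ _ hmem⟩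

/-- Induced paths from `e` to both ends of the path `f` and to `x`, pairwise anticomplete apart
from `e`. -/
structure IsFork (G : SimpleGraph V) (f : ℕ → V) (n : ℕ) (x e : V) (A B X : Set V)
    (nA nB nX s t : ℕ) : Prop where
  pathA : IndPath G e (f 0) A nA
  pathB : IndPath G e (f n) B nB
  stem : IndPath G e x X nX
  lt : s + 2 ≤ t
  le : t ≤ n
  apex : e = x ∨ ∃ v, 0 < v ∧ v < n ∧ e = f v
  memA : ∀ z ∈ A, z = e ∨ ∃ u ≤ s, z = f u
  memB : ∀ z ∈ B, z = e ∨ ∃ u, t ≤ u ∧ u ≤ n ∧ z = f u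
  memX : ∀ z ∈ X, z = e ∨ z = x
  sepA : x ≠ e → ∀ z ∈ A, z ≠ e → ¬ G.Adj x z
  sepB : x ≠ e → ∀ z ∈ B, z ≠ e → ¬ G.Adj x z

theorem exists_isFork {f : ℕ → V} {n m : ℕ} (hf : IsIndSeq G f n) {x : V} (hm : 0 < m)
    (hx : ∀ u ≤ n, x ≠ f u) {s t : ℕ} (hst : s ≤ t) (hms : m ≤ s) (hmt : t + m ≤ n)
    (hne : t ≠ s + 1) (hxs : G.Adj x (f s)) (hxt : G.Adj x (f t))
    (hext : ∀ u ≤ n, G.Adj x (f u) → s ≤ u ∧ u ≤ t) :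
    ∃ (e : V) (A B X : Set V) (nA nB nX s' t' : ℕ),
      IsFork G f n x e A B X nA nB nX s' t' ∧ m ≤ nA ∧ m ≤ nB := by
  rcases eq_or_lt_of_le hst with rfl | hlt
  · refine ⟨f s, _, _, _, _, _, _, s - 1, s + 1,
      ⟨(hf.indPath (Nat.zero_le s) (by omega)).symm, hf.indPath (by omega : s ≤ n) le_rfl,
        (IndPath.singleton (f s)).glue (IndPath.singleton x) hxs.symm ?_, by omega, by omega,
        Or.inr ⟨s, by omega, by omega, rfl⟩, ?_, ?_, ?_, ?_, ?_⟩, by omega, by omega⟩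
    · rintro _ rfl _ rfl
      exact ⟨(hx s (by omega)).symm, fun _ => ⟨rfl, rfl⟩⟩
    · rintro _ ⟨u, ⟨-, hu⟩, rfl⟩
      rcases eq_or_lt_of_le hu with rfl | hu
      · exact Or.inl rfl
      · exact Or.inr ⟨u, by omega, rfl⟩
    · rintro _ ⟨u, ⟨hu, hu'⟩, rfl⟩
      rcases eq_or_lt_of_le hu with rfl | hu
      · exact Or.inl rfl
      · exact Or.inr ⟨u, hu, hu', rfl⟩
    · rintro z (rfl | rfl)
      exacts [Or.inl rfl, Or.inr rfl]
    · rintro - _ ⟨u, ⟨-, hu⟩, rfl⟩ hz ha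
      have := hext u (by omega) ha
      exact hz (by congr 1; omega)
    · rintro - _ ⟨u, ⟨-, hu⟩, rfl⟩ hz ha
      have := hext u hu ha
      exact hz (by congr 1; omega)
  · refine ⟨x, _, _, _, _, _, _, s, t,
      ⟨(IndPath.singleton x).glue (hf.indPath (Nat.zero_le s) (by omega)).symm hxs ?_,
        (IndPath.singleton x).glue (hf.indPath (by omega : t ≤ n) le_rfl) hxt ?_,
        IndPath.singleton x, by omega, by omega, Or.inl rfl, ?_, ?_, ?_, ?_, ?_⟩,
      by omega, by omega⟩
    · rintro _ rfl _ ⟨u, ⟨-, hu⟩, rfl⟩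
      refine ⟨hx u (by omega), fun ha => ⟨rfl, ?_⟩⟩
      have := hext u (by omega) ha
      congr 1
      omega
    · rintro _ rfl _ ⟨u, ⟨hu, hu'⟩, rfl⟩
      refine ⟨hx u hu', fun ha => ⟨rfl, ?_⟩⟩
      have := hext u hu' ha
      congr 1
      omega
    · rintro z (rfl | ⟨u, ⟨-, hu⟩, rfl⟩)
      exacts [Or.inl rfl, Or.inr ⟨u, hu, rfl⟩]
    · rintro z (rfl | ⟨u, ⟨hu, hu'⟩, rfl⟩)
      exacts [Or.inl rfl, Or.inr ⟨u, hu, hu', rfl⟩]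
    · exact fun z hz => Or.inl hz
    · exact fun h => (h rfl).elim
    · exact fun h => (h rfl).elim

theorem exists_link {f : ℕ → V} {n : ℕ} (hf : IsIndSeq G f n) {x y : V}
    (hx : ∃ u ≤ n, G.Adj x (f u)) (hy : ∃ u ≤ n, G.Adj y (f u)) :
    ∃ (c d : ℕ) (Q : Set V) (N : ℕ), c ≤ n ∧ d ≤ n ∧ G.Adj x (f c) ∧ G.Adj y (f d) ∧
      IndPath G (f c) (f d) Q N ∧ ∀ z ∈ Q,
        (∃ u, min c d ≤ u ∧ u ≤ max c d ∧ z = f u) ∧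
        (G.Adj x z → z = f c) ∧ (G.Adj y z → z = f d) := by
  classical
  have hex : ∃ L c d, c ≤ n ∧ d ≤ n ∧ G.Adj x (f c) ∧ G.Adj y (f d) ∧ c ≤ d + L ∧ d ≤ c + L := by
    obtain ⟨c, hc, hxc⟩ := hx
    obtain ⟨d, hd, hyd⟩ := hy
    exact ⟨n, c, d, hc, hd, hxc, hyd, by omega, by omega⟩
  obtain ⟨c, d, hc, hd, hxc, hyd, hcd, hdc⟩ := Nat.find_spec hex
  have hmin : ∀ u w, u ≤ n → w ≤ n → G.Adj x (f u) → G.Adj y (f w) →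
      Nat.find hex ≤ max (u - w) (w - u) := fun u w hu hw hxu hyw =>
    Nat.find_min' hex ⟨u, w, hu, hw, hxu, hyw, by omega, by omega⟩
  rcases le_total c d with h | h
  · refine ⟨c, d, _, _, hc, hd, hxc, hyd, hf.indPath h hd, ?_⟩
    rintro _ ⟨u, ⟨hu, hu'⟩, rfl⟩
    refine ⟨⟨u, by omega, by omega, rfl⟩, fun ha => ?_, fun ha => ?_⟩
    · have := hmin u d (by omega) hd ha hyd
      congr 1
      omega
    · have := hmin c u hc (by omega) hxc ha
      congr 1
      omega
  · refine ⟨c, d, _, _, hc, hd, hxc, hyd, (hf.indPath h hc).symm, ?_⟩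
    rintro _ ⟨u, ⟨hu, hu'⟩, rfl⟩
    refine ⟨⟨u, by omega, by omega, rfl⟩, fun ha => ?_, fun ha => ?_⟩
    · have := hmin u d (by omega) hd ha hyd
      congr 1
      omega
    · have := hmin c u hc (by omega) hxc ha
      congr 1
      omega

theorem IsFork.apex_far {f : Fin 3 → ℕ → V} {n : Fin 3 → ℕ} (hf : IsPrismSeq G f n) {i j : Fin 3}
    (hij : i ≠ j) {x e : V} {A B X : Set V} {nA nB nX s t : ℕ}
    (h : IsFork G (f j) (n j) x e A B X nA nB nX s t)
    (hx : ∀ u ≤ n i, x ≠ f i u ∧ ¬ G.Adj x (f i u)) :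
    ∀ u ≤ n i, e ≠ f i u ∧ ¬ G.Adj e (f i u) := by
  intro u hu
  rcases h.apex with rfl | ⟨v, hv, hv', rfl⟩
  · exact hx u hu
  · refine ⟨hf.ne hij.symm (by omega) hu, fun ha => ?_⟩
    have := (hf.adj hij.symm (by omega) hu).1 ha
    omega

/-- Two forks with nonadjacent stem ends `x`, `y`, on different paths of a near-prism, together
with an induced path between `x` and `y` through the third path of the near-prism, give a
theta. -/
theorem IsFork.hasLongTheta {ℓ m : ℕ} {f : Fin 3 → ℕ → V} {n : Fin 3 → ℕ}
    (hf : IsPrismSeq G f n) (hm : ℓ ≤ 2 * m + 2) (hm' : 0 < m) {i j k : Fin 3}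
    (hij : i ≠ j) (hik : i ≠ k) (hjk : j ≠ k)
    {x y : V} (hx : IsCentral G f n m x) (hy : IsCentral G f n m y) (hxy : ¬ G.Adj x y)
    (hxy' : x ≠ y)
    (hxi : ∀ u ≤ n i, ¬ G.Adj x (f i u)) (hyj : ∀ u ≤ n j, ¬ G.Adj y (f j u))
    (hxk : ∃ u ≤ n k, G.Adj x (f k u)) (hyk : ∃ u ≤ n k, G.Adj y (f k u))
    {e e' : V} {A B X A' B' X' : Set V} {nA nB nX s t nA' nB' nX' s' t' : ℕ}
    (h : IsFork G (f j) (n j) x e A B X nA nB nX s t) (hA : m ≤ nA) (hB : m ≤ nB)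
    (h' : IsFork G (f i) (n i) y e' A' B' X' nA' nB' nX' s' t') (hA' : m ≤ nA') (hB' : m ≤ nB') :
    HasLongTheta G ℓ := by
  obtain ⟨c, d, Q, N, hc, hd, hxc, hyd, hQ, hQm⟩ := exists_link (hf.seq k) hxk hyk
  have hcb := hx.bound k c hc hxc
  have hdb := hy.bound k d hd hyd
  have hxi' : ∀ u ≤ n i, x ≠ f i u ∧ ¬ G.Adj x (f i u) := fun u hu => ⟨hx.ne i u hu, hxi u hu⟩
  have hyj' : ∀ u ≤ n j, y ≠ f j u ∧ ¬ G.Adj y (f j u) := fun u hu => ⟨hy.ne j u hu, hyj u hu⟩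
  have hei := h.apex_far hf hij hxi'
  have hej := h'.apex_far hf hij.symm hyj'
  have hey : e ≠ y ∧ ¬ G.Adj e y := by
    rcases h.apex with rfl | ⟨v, hv, hv', rfl⟩
    · exact ⟨hxy', hxy⟩
    · exact ⟨(hyj' v hv'.le).1.symm, fun ha => (hyj' v hv'.le).2 ha.symm⟩
  have hex : e' ≠ x ∧ ¬ G.Adj e' x := by
    rcases h'.apex with rfl | ⟨v, hv, hv', rfl⟩
    · exact ⟨hxy'.symm, fun ha => hxy ha.symm⟩
    · exact ⟨(hxi' v hv'.le).1.symm, fun ha => (hxi' v hv'.le).2 ha.symm⟩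
  have hee : e ≠ e' ∧ ¬ G.Adj e e' := by
    rcases h'.apex with rfl | ⟨v, hv, hv', rfl⟩
    · exact hey
    · exact hei v hv'.le
  have hlt := h.lt
  have hle := h.le
  have hlt' := h'.lt
  have hle' := h'.le
  have hQu : ∀ z ∈ Q, ∃ u, 0 < u ∧ u < n k ∧ z = f k u := by
    intro z hz
    obtain ⟨⟨u, hu, hu', rfl⟩, -⟩ := hQm z hz
    exact ⟨u, by omega, by omega, rfl⟩
  have far : ∀ i', i' ≠ k → ∀ u ≤ n i', ∀ z ∈ Q, f i' u ≠ z ∧ ¬ G.Adj (f i' u) z := by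
    intro i' hi' u hu z hz
    obtain ⟨w, hw, hw', rfl⟩ := hQu z hz
    refine ⟨hf.ne hi' hu hw'.le, fun ha => ?_⟩
    have := (hf.adj hi' hu hw'.le).1 ha
    omega
  have hxQ : ∀ z ∈ Q, x ≠ z := by
    intro z hz
    obtain ⟨w, hw, hw', rfl⟩ := hQu z hz
    exact hx.ne k w hw'.le
  have hyQ : ∀ z ∈ Q, y ≠ z := by
    intro z hz
    obtain ⟨w, hw, hw', rfl⟩ := hQu z hz
    exact hy.ne k w hw'.le
  have cross : ∀ u ≤ n j, ∀ w ≤ n i, ¬ (u = 0 ∧ w = 0) → ¬ (u = n j ∧ w = n i) →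
      f j u ≠ f i w ∧ ¬ G.Adj (f j u) (f i w) := by
    intro u hu w hw h0 h1
    refine ⟨hf.ne hij.symm hu hw, fun ha => ?_⟩
    have := (hf.adj hij.symm hu hw).1 ha
    tauto
  have inner : ∀ i, ∀ u w, u + 2 ≤ w → w ≤ n i → f i u ≠ f i w ∧ ¬ G.Adj (f i u) (f i w) := by
    intro i u w huw hw
    refine ⟨fun he => ?_, fun ha => ?_⟩
    · have := (hf.seq i).inj (by omega) hw he
      omega
    · have := ((hf.seq i).adj (by omega) hw).1 ha
      omega
  have p₁ := h.pathA.glue h'.pathA.symm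
    ((hf.adj hij.symm (by omega) (by omega)).2 (Or.inl ⟨rfl, rfl⟩))
    (by
      intro z hz w hw
      rcases h.memA z hz with rfl | ⟨u, hu, rfl⟩ <;> rcases h'.memA w hw with rfl | ⟨u', hu', rfl⟩
      · exact ⟨hee.1, fun ha => (hee.2 ha).elim⟩
      · exact ⟨(hei u' (by omega)).1, fun ha => ((hei u' (by omega)).2 ha).elim⟩
      · exact ⟨(hej u (by omega)).1.symm, fun ha => ((hej u (by omega)).2 ha.symm).elim⟩
      · refine ⟨hf.ne hij.symm (by omega) (by omega), fun ha => ?_⟩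
        rcases (hf.adj hij.symm (by omega) (by omega)).1 ha with ⟨rfl, rfl⟩ | h
        · exact ⟨rfl, rfl⟩
        · omega)
  have p₂ := h.pathB.glue h'.pathB.symm
    ((hf.adj hij.symm le_rfl le_rfl).2 (Or.inr ⟨rfl, rfl⟩))
    (by
      intro z hz w hw
      rcases h.memB z hz with rfl | ⟨u, hu, hun, rfl⟩ <;>
        rcases h'.memB w hw with rfl | ⟨u', hu', hun', rfl⟩
      · exact ⟨hee.1, fun ha => (hee.2 ha).elim⟩
      · exact ⟨(hei u' hun').1, fun ha => ((hei u' hun').2 ha).elim⟩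
      · exact ⟨(hej u hun).1.symm, fun ha => ((hej u hun).2 ha.symm).elim⟩
      · refine ⟨hf.ne hij.symm hun hun', fun ha => ?_⟩
        rcases (hf.adj hij.symm hun hun').1 ha with h | ⟨rfl, rfl⟩
        · omega
        · exact ⟨rfl, rfl⟩)
  have heQ : ∀ z ∈ Q, e ≠ z ∧ (G.Adj e z → e = x ∧ z = f k c) := by
    intro z hz
    rcases h.apex with rfl | ⟨v, hv, hv', rfl⟩
    · exact ⟨hxQ z hz, fun ha => ⟨rfl, (hQm z hz).2.1 ha⟩⟩
    · have := far j hjk v hv'.le z hz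
      exact ⟨this.1, fun ha => (this.2 ha).elim⟩
  have heQ' : ∀ z ∈ Q, e' ≠ z ∧ (G.Adj e' z → e' = y ∧ z = f k d) := by
    intro z hz
    rcases h'.apex with rfl | ⟨v, hv, hv', rfl⟩
    · exact ⟨hyQ z hz, fun ha => ⟨rfl, (hQm z hz).2.2 ha⟩⟩
    · have := far i hik v hv'.le z hz
      exact ⟨this.1, fun ha => (this.2 ha).elim⟩
  have p₃ := (h.stem.glue hQ hxc
    (by
      intro z hz w hw
      rcases h.memX z hz with rfl | rfl
      · exact heQ w hw
      · exact ⟨hxQ w hw, fun ha => ⟨rfl, (hQm w hw).2.1 ha⟩⟩)).glue h'.stem.symm hyd.symm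
    (by
      rintro z (hz | hz) w hw
      · rcases h.memX z hz with rfl | rfl <;> rcases h'.memX w hw with rfl | rfl
        · exact ⟨hee.1, fun ha => (hee.2 ha).elim⟩
        · exact ⟨hey.1, fun ha => (hey.2 ha).elim⟩
        · exact ⟨hex.1.symm, fun ha => (hex.2 ha.symm).elim⟩
        · exact ⟨hxy', fun ha => (hxy ha).elim⟩
      · rcases h'.memX w hw with rfl | rfl
        · exact ⟨(heQ' z hz).1.symm, fun ha => ((heQ' z hz).2 ha.symm).symm⟩
        · exact ⟨(hyQ z hz).symm, fun ha => ⟨(hQm z hz).2.2 ha.symm, rfl⟩⟩)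
  have stemQ : ∀ z ∈ (X ∪ Q ∪ X') \ {e, e'}, (z = x ∧ x ≠ e) ∨ z ∈ Q ∨ (z = y ∧ y ≠ e') := by
    rintro z ⟨(hz | hz) | hz, hne⟩
    · rcases h.memX z hz with rfl | rfl
      · exact (hne (Or.inl rfl)).elim
      · exact Or.inl ⟨rfl, fun he => hne (Or.inl he)⟩
    · exact Or.inr (Or.inl hz)
    · rcases h'.memX z hz with rfl | rfl
      · exact (hne (Or.inr rfl)).elim
      · exact Or.inr (Or.inr ⟨rfl, fun he => hne (Or.inr he)⟩)
  refine hasLongTheta_of_indPath p₁ p₂ p₃ hee.1 hee.2 ?_ ?_ ?_ (by omega) (by omega) (by omega)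
  · rintro z ⟨hz, hzn⟩ w ⟨hw, hwn⟩
    simp only [Set.mem_insert_iff, Set.mem_singleton_iff, not_or] at hzn hwn
    rcases hz with hz | hz
    · obtain ⟨u, hu, rfl⟩ := (h.memA z hz).resolve_left hzn.1
      rcases hw with hw | hw
      · obtain ⟨u', hu', hun', rfl⟩ := (h.memB w hw).resolve_left hwn.1
        exact inner j u u' (by omega) hun'
      · obtain ⟨u', hu', hun', rfl⟩ := (h'.memB w hw).resolve_left hwn.2
        exact cross u (by omega) u' hun' (by omega) (by omega)
    · obtain ⟨u, hu, rfl⟩ := (h'.memA z hz).resolve_left hzn.2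
      rcases hw with hw | hw
      · obtain ⟨u', hu', hun', rfl⟩ := (h.memB w hw).resolve_left hwn.1
        have := cross u' hun' u (by omega) (by omega) (by omega)
        exact ⟨this.1.symm, fun ha => this.2 ha.symm⟩
      · obtain ⟨u', hu', hun', rfl⟩ := (h'.memB w hw).resolve_left hwn.2
        exact inner i u u' (by omega) hun'
  · rintro z ⟨hz, hzn⟩ w hw
    simp only [Set.mem_insert_iff, Set.mem_singleton_iff, not_or] at hzn
    rcases hz with hz | hz
    · obtain ⟨u, hu, rfl⟩ := (h.memA z hz).resolve_left hzn.1
      rcases stemQ w hw with ⟨rfl, hxe⟩ | hw | ⟨rfl, -⟩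
      · exact ⟨(hx.ne j u (by omega)).symm, fun ha => h.sepA hxe _ hz hzn.1 ha.symm⟩
      · exact far j hjk u (by omega) w hw
      · exact ⟨(hyj' u (by omega)).1.symm, fun ha => (hyj' u (by omega)).2 ha.symm⟩
    · obtain ⟨u, hu, rfl⟩ := (h'.memA z hz).resolve_left hzn.2
      rcases stemQ w hw with ⟨rfl, -⟩ | hw | ⟨rfl, hye⟩
      · exact ⟨(hxi' u (by omega)).1.symm, fun ha => (hxi' u (by omega)).2 ha.symm⟩
      · exact far i hik u (by omega) w hw
      · exact ⟨(hy.ne i u (by omega)).symm, fun ha => h'.sepA hye _ hz hzn.2 ha.symm⟩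
  · rintro z ⟨hz, hzn⟩ w hw
    simp only [Set.mem_insert_iff, Set.mem_singleton_iff, not_or] at hzn
    rcases hz with hz | hz
    · obtain ⟨u, hu, hun, rfl⟩ := (h.memB z hz).resolve_left hzn.1
      rcases stemQ w hw with ⟨rfl, hxe⟩ | hw | ⟨rfl, -⟩
      · exact ⟨(hx.ne j u hun).symm, fun ha => h.sepB hxe _ hz hzn.1 ha.symm⟩
      · exact far j hjk u hun w hw
      · exact ⟨(hyj' u hun).1.symm, fun ha => (hyj' u hun).2 ha.symm⟩
    · obtain ⟨u, hu, hun, rfl⟩ := (h'.memB z hz).resolve_left hzn.2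
      rcases stemQ w hw with ⟨rfl, -⟩ | hw | ⟨rfl, hye⟩
      · exact ⟨(hxi' u hun).1.symm, fun ha => (hxi' u hun).2 ha.symm⟩
      · exact far i hik u hun w hw
      · exact ⟨(hy.ne i u hun).symm, fun ha => h'.sepB hye _ hz hzn.2 ha.symm⟩

theorem Tidy.isCentral {ℓ : ℕ} {a b : Fin 3 → V} {P : ∀ i, G.Walk (a i) (b i)}
    (h : Tidy G ℓ P) {x : V} (hx : x ∉ prismSupport P) :
    IsCentral G (fun i => (P i).getVert) (fun i => (P i).length) (ℓ / 2 - 1) x := by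
  refine ⟨fun i t ht he => hx (mem_prismSupport.2 ⟨i, t, ht, he⟩), fun i t ht ha => ?_⟩
  have hnot : (P i).getVert t ∉ frameStar ℓ P := fun hm => (h.2 hm hx).2 ha.symm
  have htake : ∀ {u v : V} (W : G.Walk u v) {t : ℕ}, t ≤ W.length → t < ℓ / 2 - 1 →
      W.getVert t ∈ W.support.take (ℓ / 2 - 1) := by
    intro u v W t ht htm
    rw [Walk.getVert_eq_support_getElem W ht, List.mem_take_iff_getElem]
    exact ⟨t, by rw [Walk.length_support]; omega, rfl⟩
  simp only [frameStar, Set.mem_iUnion, not_exists] at hnot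
  have hi := hnot i
  split_ifs at hi with hs
  · exact (hi ((P i).getVert_mem_support t)).elim
  · rw [Set.mem_union, not_or] at hi
    refine ⟨?_, ?_⟩
    · by_contra hlt
      exact hi.1 (htake (P i) ht (by omega))
    · by_contra hlt
      refine hi.2 ?_
      have := htake (P i).reverse (t := (P i).length - t) (by rw [Walk.length_reverse]; omega)
        (by omega)
      rw [Walk.getVert_reverse, Walk.support_reverse, Nat.sub_sub_self ht] at this
      exact this

theorem Tidy.le_length {ℓ : ℕ} {a b : Fin 3 → V} {P : ∀ i, G.Walk (a i) (b i)}
    (h : Tidy G ℓ P) {x : V} (hx : x ∉ prismSupport P) {i : Fin 3} {t : ℕ}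
    (ha : G.Adj x ((P i).getVert t)) : ℓ ≤ (P i).length := by
  by_contra hlt
  refine (h.2 (Set.mem_iUnion.2 ⟨i, ?_⟩) hx).2 ha.symm
  rw [if_pos (by omega)]
  exact (P i).getVert_mem_support t

theorem prismGraph_le {a b : Fin 3 → V} {P : ∀ i, G.Walk (a i) (b i)}
    (ha : ∀ i j, i ≠ j → G.Adj (a i) (a j)) (hb : ∀ i j, i ≠ j → G.Adj (b i) (b j)) :
    prismGraph G a b P ≤ G := by
  intro u v huv
  rw [prismGraph, fromEdgeSet_adj] at huv
  rw [← mem_edgeSet]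
  rcases huv.1 with (⟨i, j, hij, he⟩ | ⟨i, j, hij, he⟩) | ⟨i, he⟩
  · rw [he]
    exact ha i j hij
  · rw [he]
    exact hb i j hij
  · exact (P i).edges_subset_edgeSet he

theorem KMajor.exists_far {ℓ : ℕ} {a b : Fin 3 → V} {P : ∀ i, G.Walk (a i) (b i)}
    (hP : IsLongNearPrism ℓ a b P) {q : V} (hq : KMajor G P q) {k : Fin 3} {s t : ℕ}
    (hst : s ≤ t) (ht : t ≤ (P k).length)
    (hext : ∀ z ∈ prismSupport P, G.Adj q z → ∃ u, s ≤ u ∧ u ≤ t ∧ z = (P k).getVert u) :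
    s + 3 ≤ t := by
  by_contra hlt
  have hf := hP.isPrismSeq.seq k
  have hseq : IsIndSeq (prismGraph G a b P) (P k).getVert (P k).length := by
    have hsucc : ∀ {u}, u + 1 ≤ (P k).length →
        (prismGraph G a b P).Adj ((P k).getVert u) ((P k).getVert (u + 1)) := by
      intro u hu
      rw [prismGraph, fromEdgeSet_adj]
      refine ⟨Or.inr ⟨k, ?_⟩, (hf.adj (by omega) hu |>.2 (Or.inl rfl)).ne⟩
      exact (Walk.mk_mem_edges_iff_exists _).2 ⟨u, hu, rfl⟩
    refine ⟨fun {u w} hu hw => ⟨fun ha => (hf.adj hu hw).1 (prismGraph_le hP.1 hP.2.1 ha), ?_⟩,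
      fun hu hw => hf.inj hu hw⟩
    rintro (rfl | rfl)
    · exact hsucc hw
    · exact (hsucc hu).symm
  obtain ⟨W, hW, hS, hl⟩ := hseq.indPath hst ht
  refine hq.2 ⟨_, _, W, hW.1, by omega, fun z hz ha => ?_⟩
  obtain ⟨u, hu, hu', rfl⟩ := hext z hz ha
  change _ ∈ vset W
  rw [hS]
  exact ⟨u, ⟨hu, hu'⟩, rfl⟩

/-- A major vertex has neighbours on at least two constituent paths. -/
theorem KMajor.exists_adj [Finite V] {ℓ : ℕ} (hℓ : 6 ≤ ℓ) (hℓeven : Even ℓ)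
    {a b : Fin 3 → V} {P : ∀ i, G.Walk (a i) (b i)} (hsh : ShortestLNP G ℓ P)
    (htidy : Tidy G ℓ P) {q : V} (hq : KMajor G P q) {i j k : Fin 3}
    (hij : i ≠ j) (hik : i ≠ k) (hjk : j ≠ k)
    (hqi : ∀ u ≤ (P i).length, ¬ G.Adj q ((P i).getVert u)) :
    ∃ u ≤ (P j).length, G.Adj q ((P j).getVert u) := by
  by_contra hqj
  push Not at hqj
  have hall : ∀ z ∈ prismSupport P, G.Adj q z →
      ∃ u ≤ (P k).length, z = (P k).getVert u := by
    intro z hz ha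
    obtain ⟨l, u, hu, rfl⟩ := mem_prismSupport.1 hz
    have hl : l = i ∨ l = j ∨ l = k := by omega
    rcases hl with rfl | rfl | rfl
    · exact (hqi u hu ha).elim
    · exact (hqj u hu ha).elim
    · exact ⟨u, hu, rfl⟩
  by_cases hqk : ∃ u ≤ (P k).length, G.Adj q ((P k).getVert u)
  · obtain ⟨s, t, hst, ht, hs, ht', hext⟩ := exists_extreme hqk
    have hfar := hq.exists_far hsh.1 hst ht fun z hz ha => by
      obtain ⟨u, hu, rfl⟩ := hall z hz ha
      exact ⟨u, (hext u hu ha).1, (hext u hu ha).2, rfl⟩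
    have hlen : ℓ ≤ (P i).length + (P j).length + 2 := by
      have := htidy.1 i j
      by_contra hlt
      exact hij (this (by omega) (by omega))
    have hm : ℓ ≤ 2 * (ℓ / 2 - 1) + 2 := by
      obtain ⟨r, rfl⟩ := hℓeven
      omega
    exact hsh.not_shortcut hℓ (fun z => mem_prismSupport) hsh.1.isPrismSeq hm hij hik hjk hlen
      (htidy.isCentral hq.1) hqi hqj hfar ht hs ht' hext
  · have := hq.exists_far hsh.1 (k := k) (le_refl 0) (Nat.zero_le _) fun z hz ha => by
      obtain ⟨u, hu, rfl⟩ := hall z hz ha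
      exact (hqk ⟨u, hu, ha⟩).elim
    omega

theorem KMajor.exists_fork [Finite V] {ℓ : ℕ} (hℓ : 6 ≤ ℓ) (hℓeven : Even ℓ)
    {a b : Fin 3 → V} {P : ∀ i, G.Walk (a i) (b i)} (hsh : ShortestLNP G ℓ P)
    (htidy : Tidy G ℓ P) {x : V} (hx : KMajor G P x) {i j k : Fin 3}
    (hij : i ≠ j) (hik : i ≠ k) (hjk : j ≠ k) (hni : ℓ ≤ (P i).length)
    (hxi : ∀ u ≤ (P i).length, ¬ G.Adj x ((P i).getVert u)) :
    ∃ (e : V) (A B X : Set V) (nA nB nX s t : ℕ),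
      IsFork G (P j).getVert (P j).length x e A B X nA nB nX s t ∧
        ℓ / 2 - 1 ≤ nA ∧ ℓ / 2 - 1 ≤ nB := by
  have hf := hsh.1.isPrismSeq
  have hc := htidy.isCentral hx.1
  obtain ⟨s, t, hst, ht, hs, ht', hext⟩ :=
    exists_extreme (hx.exists_adj hℓ hℓeven hsh htidy hij hik hjk hxi)
  refine exists_isFork (hf.seq j) (by omega) (hc.ne j) hst (hc.bound j s (by omega) hs).1
    (hc.bound j t ht ht').2 ?_ hs ht' hext
  rintro rfl
  obtain ⟨r, t', hrt, hrn, hr, -, hext'⟩ :=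
    exists_extreme (hx.exists_adj hℓ hℓeven hsh htidy hik hij hjk.symm hxi)
  have hm : ℓ ≤ 2 * (ℓ / 2 - 1) + 2 := by
    obtain ⟨r, rfl⟩ := hℓeven
    omega
  exact hsh.not_adjacent_pair hℓ (fun z => mem_prismSupport) hf hm hij hik hjk hni hc hxi ht hs ht'
    hext (hrt.trans hrn) hr fun u hu ha => (hext' u hu ha).1

end LEH

open LEH

/-- if nonadjacent `K`-major vertices `x, y` miss `V(P i)` and `V(P j)`
respectively, then `i = j`. -/
theorem notwotwos {V : Type*} [Fintype V]
    (ℓ : ℕ) (hℓ : 6 ≤ ℓ) (hℓeven : Even ℓ)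
    (G : SimpleGraph V) (hnt : ¬ HasLongTheta G ℓ)
    {a b : Fin 3 → V} (P : ∀ i : Fin 3, G.Walk (a i) (b i))
    (hsh : ShortestLNP G ℓ P) (htidy : Tidy G ℓ P)
    (x y : V) (hx : KMajor G P x) (hy : KMajor G P y) (hxy : ¬ G.Adj x y) :
    ∀ i j : Fin 3, (∀ z ∈ (P i).support, ¬ G.Adj x z) →
      (∀ z ∈ (P j).support, ¬ G.Adj y z) → i = j := by
  intro i j hxi hyj
  by_contra hij
  obtain ⟨k, hik, hjk⟩ : ∃ k, i ≠ k ∧ j ≠ k := by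
    clear hxi hyj
    revert i j
    decide
  have hxi' : ∀ u ≤ (P i).length, ¬ G.Adj x ((P i).getVert u) := fun u _ =>
    hxi _ ((P i).getVert_mem_support u)
  have hyj' : ∀ u ≤ (P j).length, ¬ G.Adj y ((P j).getVert u) := fun u _ =>
    hyj _ ((P j).getVert_mem_support u)
  have hji : j ≠ i := Ne.symm hij
  obtain ⟨u, hu, hxu⟩ := hx.exists_adj hℓ hℓeven hsh htidy hij hik hjk hxi'
  obtain ⟨w, hw, hyw⟩ := hy.exists_adj hℓ hℓeven hsh htidy hji hjk hik hyj'
  obtain ⟨e, A, B, X, nA, nB, nX, s, t, h, hA, hB⟩ := hx.exists_fork hℓ hℓeven hsh htidy hij hik hjk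
    (htidy.le_length hy.1 hyw) hxi'
  obtain ⟨e', A', B', X', nA', nB', nX', s', t', h', hA', hB'⟩ :=
    hy.exists_fork hℓ hℓeven hsh htidy hji hjk hik (htidy.le_length hx.1 hxu) hyj'
  refine hnt (h.hasLongTheta hsh.1.isPrismSeq (m := ℓ / 2 - 1) ?_ (by omega) hij hik hjk
    (htidy.isCentral hx.1) (htidy.isCentral hy.1) hxy ?_ hxi' hyj'
    (hx.exists_adj hℓ hℓeven hsh htidy hik hij hjk.symm hxi')
    (hy.exists_adj hℓ hℓeven hsh htidy hjk hji hik.symm hyj') hA hB h' hA' hB')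
  · obtain ⟨r, rfl⟩ := hℓeven
    omega
  · rintro rfl
    exact hyj' u hu hxu
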